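/- arXiv:1707.01634 — 2 statements merged into one kernel-verified Lean document; each statement's English description precedes it below -/
import Mathlib

section
/- Let G be a connected non-complete graph of order n with 4 ≤ n ≤ 8 such that the subgraph induced by the cut edges of G is a linear forest. If δ(G) ≥ 2, then cfc(G) = 2. -/
open SimpleGraph

/-- Degree of a vertex. -/
noncomputable def vdeg {V : Type*} (G : SimpleGraph V) (v : V) : ℕ := (G.neighborSet v).ncard

/-- An edge-coloring `c` makes `G` conflict-free connected if any two distinct vertices are
joined by a path on which some color appears on exactly one edge. -/
def IsCFConnected {V : Type*} (G : SimpleGraph V) (c : Sym2 V → ℕ) : Prop :=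
  ∀ u v : V, u ≠ v → ∃ p : G.Walk u v, p.IsPath ∧
    ∃ col : ℕ, (p.edges.filter (fun e => c e = col)).length = 1

/-- The conflict-free connection number of `G`. -/
noncomputable def cfcNum {V : Type*} (G : SimpleGraph V) : ℕ :=
  sInf {k | ∃ c : Sym2 V → ℕ, (∀ e ∈ G.edgeSet, c e < k) ∧ IsCFConnected G c}

/-- The subgraph `C(G)` spanned by the cut edges (bridges) of `G`. -/
def bridgeGraph {V : Type*} (G : SimpleGraph V) : SimpleGraph V :=
  SimpleGraph.fromEdgeSet {e | G.IsBridge e}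

/-- A linear forest: an acyclic graph with maximum degree at most two. -/
def IsLinearForest {V : Type*} (H : SimpleGraph V) : Prop :=
  H.IsAcyclic ∧ ∀ v, (H.neighborSet v).ncard ≤ 2

section PathCounts

variable {V : Type*} {G : SimpleGraph V}

open Classical in
/-- There is a path from `x` to `y` inside `S` with exactly `k` edges in `F`. -/
def HasPathCount (G : SimpleGraph V) (F : Set (Sym2 V)) (S : Set V) (k : ℕ) (x y : V) : Prop :=
  ∃ p : G.Walk x y, p.IsPath ∧ (∀ z ∈ p.support, z ∈ S) ∧
    p.edges.countP (fun e => decide (e ∈ F)) = k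

/-- Any two distinct vertices of `S` are joined inside `S` both by a path avoiding `F` and by a
path with exactly one edge in `F`. -/
structure IsGoodOn (G : SimpleGraph V) (F : Set (Sym2 V)) (S : Set V) : Prop where
  mem_of_mem : ∀ e ∈ F, ∀ z ∈ e, z ∈ S
  zero : ∀ x ∈ S, ∀ y ∈ S, HasPathCount G F S 0 x y
  one : ∀ x ∈ S, ∀ y ∈ S, x ≠ y → HasPathCount G F S 1 x y

/-- The variant of `IsGoodOn` that exempts adjacent vertices from the second requirement. -/
structure IsNearlyGoodOn (G : SimpleGraph V) (F : Set (Sym2 V)) (S : Set V) : Prop where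
  mem_of_mem : ∀ e ∈ F, ∀ z ∈ e, z ∈ S
  zero : ∀ x ∈ S, ∀ y ∈ S, HasPathCount G F S 0 x y
  one : ∀ x ∈ S, ∀ y ∈ S, x ≠ y → G.Adj x y ∨ HasPathCount G F S 1 x y

namespace HasPathCount

variable {F F' : Set (Sym2 V)} {S T A B : Set V} {i j k : ℕ} {x y z t : V}

lemma refl (hx : x ∈ S) : HasPathCount G F S 0 x x :=
  ⟨Walk.nil, Walk.IsPath.nil, by simpa using hx, by simp⟩

lemma symm (h : HasPathCount G F S k x y) : HasPathCount G F S k y x := by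
  obtain ⟨p, hp, hS, hk⟩ := h
  refine ⟨p.reverse, hp.reverse, by simpa using hS, ?_⟩
  rw [Walk.edges_reverse, List.countP_reverse, hk]

lemma mono (h : HasPathCount G F S k x y) (hST : S ⊆ T) : HasPathCount G F T k x y := by
  obtain ⟨p, hp, hS, hk⟩ := h
  exact ⟨p, hp, fun z hz => hST (hS z hz), hk⟩

lemma congr (h : HasPathCount G F S k x y)
    (hF : ∀ e, (∀ z ∈ e, z ∈ S) → (e ∈ F ↔ e ∈ F')) : HasPathCount G F' S k x y := by
  classical
  obtain ⟨p, hp, hS, hk⟩ := h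
  refine ⟨p, hp, hS, ?_⟩
  rw [← hk]
  refine List.countP_congr fun e he => ?_
  have := hF e fun z hz => hS z (Walk.mem_support_of_mem_edges he hz)
  simp [this]

open Classical in
lemma glue (h₁ : HasPathCount G F A i x y) (h : G.Adj y z) (h₂ : HasPathCount G F B j z t)
    (hAB : Disjoint A B) :
    HasPathCount G F (A ∪ B) (i + (if s(y, z) ∈ F then 1 else 0) + j) x t := by
  obtain ⟨p, hp, hpA, rfl⟩ := h₁
  obtain ⟨q, hq, hqB, rfl⟩ := h₂
  refine ⟨p.append (Walk.cons h q), ?_, ?_, ?_⟩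
  · rw [Walk.isPath_def, Walk.support_append, Walk.support_cons, List.tail_cons,
      List.nodup_append']
    refine ⟨hp.support_nodup, hq.support_nodup, fun u hu hu' => ?_⟩
    exact Set.disjoint_left.mp hAB (hpA u hu) (hqB u hu')
  · intro u hu
    rw [Walk.support_append, Walk.support_cons, List.tail_cons, List.mem_append] at hu
    exact hu.imp (hpA u) (hqB u)
  · rw [Walk.edges_append, Walk.edges_cons, List.countP_append, List.countP_cons]
    by_cases hF : s(y, z) ∈ F <;> simp +arith [hF]

lemma glue_of_notMem (h₁ : HasPathCount G F A i x y) (h : G.Adj y z)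
    (h₂ : HasPathCount G F B j z t) (hAB : Disjoint A B) (hF : s(y, z) ∉ F) :
    HasPathCount G F (A ∪ B) (i + j) x t := by
  simpa [hF] using h₁.glue h h₂ hAB

lemma glue_of_mem (h₁ : HasPathCount G F A i x y) (h : G.Adj y z)
    (h₂ : HasPathCount G F B j z t) (hAB : Disjoint A B) (hF : s(y, z) ∈ F) :
    HasPathCount G F (A ∪ B) (i + 1 + j) x t := by
  simpa [hF] using h₁.glue h h₂ hAB

lemma of_walk (p : G.Walk x y) (hp : ∀ z ∈ p.support, z ∈ S) : HasPathCount G ∅ S 0 x y := by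
  classical
  exact ⟨p.bypass, p.bypass_isPath, fun z hz => hp z (p.support_bypass_subset_support hz), by simp⟩

lemma trans_empty (h₁ : HasPathCount G ∅ S i x y) (h₂ : HasPathCount G ∅ S j y z) :
    HasPathCount G ∅ S 0 x z := by
  obtain ⟨p, -, hp, -⟩ := h₁
  obtain ⟨q, -, hq, -⟩ := h₂
  refine of_walk (p.append q) fun u hu => ?_
  rw [Walk.mem_support_append_iff] at hu
  exact hu.elim (hp u) (hq u)

lemma empty (h : HasPathCount G F S k x y) : HasPathCount G ∅ S 0 x y := by
  obtain ⟨p, -, hp, -⟩ := h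
  exact of_walk p hp

lemma of_adj (h : G.Adj x y) (hx : x ∈ S) (hy : y ∈ S) : HasPathCount G ∅ S 0 x y :=
  of_walk h.toWalk (by simp [hx, hy])

lemma right_mem (h : HasPathCount G F S k x y) : y ∈ S := by
  obtain ⟨p, -, hp, -⟩ := h
  exact hp y p.end_mem_support

/-- The empty edge set may be replaced by one without edges inside the region. -/
lemma of_empty (h : HasPathCount G ∅ S k x y) (hF : ∀ e ∈ F, ∃ z ∈ e, z ∉ S) :
    HasPathCount G F S k x y := by
  refine h.congr fun e he => ⟨fun h => h.elim, fun h => ?_⟩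
  obtain ⟨z, hz, hzS⟩ := hF e h
  exact hzS (he z hz)

end HasPathCount

/-- Two distinct vertices on a path can be linked to the two ends disjointly. -/
lemma SimpleGraph.Walk.IsPath.exists_disjoint_links {v w : V} {q : G.Walk v w} (hq : q.IsPath)
    {x y : V} (hx : x ∈ q.support) (hy : y ∈ q.support) (hxy : x ≠ y) :
    ∃ A B : Set V, Disjoint A B ∧ A ⊆ {z | z ∈ q.support} ∧ B ⊆ {z | z ∈ q.support} ∧
      ((HasPathCount G ∅ A 0 x v ∧ HasPathCount G ∅ B 0 w y) ∨
        (HasPathCount G ∅ A 0 y v ∧ HasPathCount G ∅ B 0 w x)) := by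
  classical
  induction q with
  | nil => simp_all
  | @cons v u w h q ih =>
    rw [Walk.cons_isPath_iff] at hq
    obtain ⟨hq, hv⟩ := hq
    have link : ∀ z ∈ q.support, HasPathCount G ∅ {z | z ∈ q.support} 0 w z := fun z hz =>
      (HasPathCount.of_walk (q.dropUntil z hz)
        fun t ht => q.support_dropUntil_subset_support hz ht).symm
    have hdisj : Disjoint ({v} : Set V) {z | z ∈ q.support} := by simpa using hv
    have hsub : ({v} : Set V) ⊆ {z | z ∈ (Walk.cons h q).support} := by simp
    have hsub' : {z | z ∈ q.support} ⊆ {z | z ∈ (Walk.cons h q).support} := by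
      intro z hz; simp only [Set.mem_ofPred_eq, Walk.support_cons, List.mem_cons]; exact Or.inr hz
    rw [Walk.support_cons, List.mem_cons] at hx hy
    rcases hx with rfl | hx
    · have hy : y ∈ q.support := hy.resolve_left (Ne.symm hxy)
      exact ⟨_, _, hdisj, hsub, hsub', Or.inl ⟨.refl rfl, link y hy⟩⟩
    rcases hy with rfl | hy
    · exact ⟨_, _, hdisj, hsub, hsub', Or.inr ⟨.refl rfl, link x hx⟩⟩
    obtain ⟨A, B, hAB, hA, hB, hc⟩ := ih hq hx hy
    have hAv : Disjoint A {v} := (hdisj.mono_right hA).symm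
    refine ⟨A ∪ {v}, B, ?_, Set.union_subset (hA.trans hsub') hsub, hB.trans hsub', ?_⟩
    · exact Set.disjoint_union_left.mpr ⟨hAB, hdisj.mono_right hB⟩
    · have ext : ∀ {r}, HasPathCount G ∅ A 0 r u → HasPathCount G ∅ (A ∪ {v}) 0 r v := fun hr =>
        hr.glue_of_notMem h.symm (.refl (Set.mem_singleton v)) hAv (by simp)
      exact hc.imp (And.imp_left ext) (And.imp_left ext)

lemma isGoodOn_singleton (a : V) : IsGoodOn G ∅ {a} where
  mem_of_mem := by simp
  zero := by rintro x rfl y rfl; exact .refl rfl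
  one := by rintro x rfl y rfl h; exact (h rfl).elim

namespace IsGoodOn

variable {F : Set (Sym2 V)} {S : Set V}

/-- Attaching an ear: a path outside `S` whose ends are joined to `S` by two different edges. -/
lemma union_ear (hS : IsGoodOn G F S) {a b v w : V} (ha : a ∈ S) (hb : b ∈ S) {q : G.Walk v w}
    (hq : q.IsPath) (hqS : ∀ z ∈ q.support, z ∉ S) (hav : G.Adj a v) (hbw : G.Adj b w)
    (hne : a = b → v ≠ w) :
    IsGoodOn G (F ∪ {e | e = s(a, v) ∧ a = b}) (S ∪ {z | z ∈ q.support}) := by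
  classical
  set F' := F ∪ {e | e = s(a, v) ∧ a = b} with hF'
  set Q : Set V := {z | z ∈ q.support} with hQ
  have hvQ : v ∈ Q := q.start_mem_support
  have hwQ : w ∈ Q := q.end_mem_support
  have hdisj : Disjoint Q S := Set.disjoint_left.mpr hqS
  have hF'Q : ∀ A ⊆ Q, ∀ e ∈ F', ∃ z ∈ e, z ∉ A := by
    intro A hA e he
    rcases he with he | ⟨rfl, -⟩
    · induction e with
      | _ x y =>
        exact ⟨x, by simp, fun hx => hqS x (hA hx) (hS.mem_of_mem _ he x (by simp))⟩
    · exact ⟨a, by simp, fun h => hqS a (hA h) ha⟩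
  have hF'S : ∀ {k x y}, HasPathCount G F S k x y → HasPathCount G F' S k x y := by
    intro k x y h
    refine h.congr fun e he => ⟨Or.inl, ?_⟩
    rintro (h | ⟨rfl, -⟩)
    · exact h
    · exact (hqS v hvQ (he v (by simp))).elim
  have hbwF : s(b, w) ∉ F' := by
    rintro (h | ⟨h, rfl⟩)
    · exact hqS w hwQ (hS.mem_of_mem _ h w (by simp))
    · rw [Sym2.congr_right] at h
      exact hne rfl h.symm
  have key : ∀ {x} {A : Set V}, A ⊆ Q → HasPathCount G ∅ A 0 x v →
      HasPathCount G F' (A ∪ S) 1 x b := by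
    intro x A hA hx
    have hx' := hx.of_empty (hF'Q A hA)
    by_cases hab : a = b
    · subst hab
      have hmem : s(v, a) ∈ F' := Or.inr ⟨Sym2.eq_swap, rfl⟩
      simpa using hx'.glue_of_mem hav.symm (.refl ha) (hdisj.mono_left hA) hmem
    · have hmem : s(v, a) ∉ F' := by
        rintro (h | ⟨-, h⟩)
        · exact hqS v hvQ (hS.mem_of_mem _ h v (by simp))
        · exact hab h
      simpa using hx'.glue_of_notMem hav.symm (hF'S (hS.one a ha b hb hab))
        (hdisj.mono_left hA) hmem
  have linkW : ∀ x ∈ Q, HasPathCount G F' Q 0 x w := fun x hx =>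
    (HasPathCount.of_walk (q.dropUntil x hx)
      fun t ht => q.support_dropUntil_subset_support hx ht).of_empty (hF'Q Q le_rfl)
  have linkV : ∀ x ∈ Q, HasPathCount G ∅ Q 0 x v := fun x hx =>
    (HasPathCount.of_walk (q.takeUntil x hx)
      fun t ht => q.support_takeUntil_subset_support hx ht).symm
  have hwb : s(w, b) ∉ F' := by rwa [Sym2.eq_swap]
  have comm : Q ∪ S = S ∪ Q := Set.union_comm _ _
  have zeroQS : ∀ x ∈ Q, ∀ y ∈ S, HasPathCount G F' (S ∪ Q) 0 x y := fun x hx y hy => by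
    rw [← comm]
    simpa using (linkW x hx).glue_of_notMem hbw.symm (hF'S (hS.zero b hb y hy)) hdisj hwb
  have oneQS : ∀ x ∈ Q, ∀ y ∈ S, HasPathCount G F' (S ∪ Q) 1 x y := fun x hx y hy => by
    rw [← comm]
    by_cases hyb : b = y
    · subst hyb
      exact key le_rfl (linkV x hx)
    · simpa using (linkW x hx).glue_of_notMem hbw.symm (hF'S (hS.one b hb y hy hyb)) hdisj hwb
  refine ⟨?_, ?_, ?_⟩
  · rintro e (he | ⟨rfl, -⟩) z hz
    · exact Or.inl (hS.mem_of_mem e he z hz)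
    · rcases Sym2.mem_iff.mp hz with rfl | rfl
      exacts [Or.inl ha, Or.inr hvQ]
  · rintro x (hx | hx) y (hy | hy)
    · exact (hF'S (hS.zero x hx y hy)).mono Set.subset_union_left
    · exact (zeroQS y hy x hx).symm
    · exact zeroQS x hx y hy
    · exact (((linkV x hx).trans_empty (linkV y hy).symm).of_empty (hF'Q Q le_rfl)).mono
        Set.subset_union_right
  · rintro x (hx | hx) y (hy | hy) hxy
    · exact (hF'S (hS.one x hx y hy hxy)).mono Set.subset_union_left
    · exact (oneQS y hy x hx).symm
    · exact oneQS x hx y hy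
    · obtain ⟨A, B, hAB, hA, hB, hc⟩ := hq.exists_disjoint_links hx hy hxy
      have hd : Disjoint (A ∪ S) B :=
        Set.disjoint_union_left.mpr ⟨hAB, (hdisj.mono_left hB).symm⟩
      have hsub : A ∪ S ∪ B ⊆ S ∪ Q :=
        Set.union_subset (Set.union_subset (hA.trans Set.subset_union_right)
          Set.subset_union_left) (hB.trans Set.subset_union_right)
      have join : ∀ {r t}, HasPathCount G ∅ A 0 r v ∧ HasPathCount G ∅ B 0 w t →
          HasPathCount G F' (S ∪ Q) 1 r t := by
        rintro r t ⟨hr, ht⟩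
        have := (key hA hr).glue_of_notMem hbw (ht.of_empty (hF'Q B hB)) hd hbwF
        exact (by simpa using this : HasPathCount G F' (A ∪ S ∪ B) 1 r t).mono hsub
      rcases hc with hc | hc
      exacts [join hc, (join hc).symm]

lemma isNearlyGoodOn (hS : IsGoodOn G F S) : IsNearlyGoodOn G F S :=
  ⟨hS.mem_of_mem, hS.zero, fun x hx y hy hxy => Or.inr (hS.one x hx y hy hxy)⟩

lemma insert_pendant (hS : IsGoodOn G F S) {d s : V} (hd : d ∉ S) (hs : s ∈ S)
    (hds : G.Adj d s) : IsNearlyGoodOn G F (insert d S) := by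
  have hdisj : Disjoint ({d} : Set V) S := by simpa using hd
  have hF : s(d, s) ∉ F := fun h => hd (hS.mem_of_mem _ h d (by simp))
  have zero : ∀ y ∈ S, HasPathCount G F (insert d S) 0 d y := fun y hy =>
    (HasPathCount.refl (Set.mem_singleton d)).glue_of_notMem hds (hS.zero s hs y hy) hdisj hF
  have one : ∀ y ∈ S, G.Adj d y ∨ HasPathCount G F (insert d S) 1 d y := fun y hy => by
    by_cases hsy : s = y
    · exact Or.inl (hsy ▸ hds)
    · exact Or.inr
        ((HasPathCount.refl (Set.mem_singleton d)).glue_of_notMem hds (hS.one s hs y hy hsy) hdisj hF)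
  refine ⟨fun e he z hz => Or.inr (hS.mem_of_mem e he z hz), ?_, ?_⟩
  · rintro x (rfl | hx) y (rfl | hy)
    · exact .refl (Or.inl rfl)
    · exact zero y hy
    · exact (zero x hx).symm
    · exact (hS.zero x hx y hy).mono (Set.subset_insert _ _)
  · rintro x (rfl | hx) y (rfl | hy) hxy
    · exact (hxy rfl).elim
    · exact one y hy
    · exact (one x hx).imp .symm .symm
    · exact Or.inr ((hS.one x hx y hy hxy).mono (Set.subset_insert _ _))

end IsGoodOn

/-- Two nearly good sets covering all vertices and joined by an edge. -/
lemma IsNearlyGoodOn.glue {F₁ F₂ : Set (Sym2 V)} {L R : Set V} (hL : IsNearlyGoodOn G F₁ L)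
    (hR : IsNearlyGoodOn G F₂ R) (hLR : Disjoint L R) (hcover : ∀ x, x ∈ L ∨ x ∈ R) {l r : V}
    (hl : l ∈ L) (hr : r ∈ R) (hadj : G.Adj l r) :
    ∃ F : Set (Sym2 V), ∀ x y, x ≠ y → G.Adj x y ∨ HasPathCount G F Set.univ 1 x y := by
  set F : Set (Sym2 V) := F₁ ∪ F₂ ∪ {s(l, r)} with hF
  have hd := Set.disjoint_left.mp hLR
  have toL : ∀ {k x y}, HasPathCount G F₁ L k x y → HasPathCount G F L k x y := by
    intro k x y h
    refine h.congr fun e he => ⟨fun h => Or.inl (Or.inl h), ?_⟩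
    rintro ((h | h) | rfl)
    · exact h
    · induction e with
      | _ u t => exact (hd (he u (by simp)) (hR.mem_of_mem _ h u (by simp))).elim
    · exact (hd (he r (by simp)) hr).elim
  have toR : ∀ {k x y}, HasPathCount G F₂ R k x y → HasPathCount G F R k x y := by
    intro k x y h
    refine h.congr fun e he => ⟨fun h => Or.inl (Or.inr h), ?_⟩
    rintro ((h | h) | rfl)
    · induction e with
      | _ u t => exact (hd (hL.mem_of_mem _ h u (by simp)) (he u (by simp))).elim
    · exact h
    · exact (hd hl (he l (by simp))).elim
  have cross : ∀ x ∈ L, ∀ y ∈ R, HasPathCount G F Set.univ 1 x y := fun x hx y hy =>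
    (HasPathCount.mono (by
      simpa using (toL (hL.zero x hx l hl)).glue_of_mem hadj (toR (hR.zero r hr y hy)) hLR
        (Or.inr rfl)) (Set.subset_univ _))
  refine ⟨F, fun x y hxy => ?_⟩
  rcases hcover x with hx | hx <;> rcases hcover y with hy | hy
  · exact (hL.one x hx y hy hxy).imp_right fun h => (toL h).mono (Set.subset_univ _)
  · exact Or.inr (cross x hx y hy)
  · exact Or.inr (cross y hy x hx).symm
  · exact (hR.one x hx y hy hxy).imp_right fun h => (toR h).mono (Set.subset_univ _)

lemma exists_isCFConnected_of_hasPathCount {F : Set (Sym2 V)}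
    (hF : ∀ x y, x ≠ y → G.Adj x y ∨ HasPathCount G F Set.univ 1 x y) :
    ∃ c : Sym2 V → ℕ, (∀ e ∈ G.edgeSet, c e < 2) ∧ IsCFConnected G c := by
  classical
  refine ⟨fun e => if e ∈ F then 1 else 0, fun e _ => by dsimp only; split_ifs <;> omega,
    fun x y hxy => ?_⟩
  rcases hF x y hxy with h | ⟨p, hp, -, hk⟩
  · exact ⟨h.toWalk, by simp [hxy], if s(x, y) ∈ F then 1 else 0, by simp⟩
  · refine ⟨p, hp, 1, ?_⟩
    rw [← List.countP_eq_length_filter]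
    refine (List.countP_congr fun e _ => ?_).trans hk
    by_cases h : e ∈ F <;> simp [h]

/-- A region in which all vertices but one have two neighbours contains a cycle. -/
lemma exists_isGoodOn_subset [Finite V] {U : Set V} {v u : V} (hv : v ∈ U) (hu : u ∈ U)
    (huv : G.Adj u v)
    (hU : ∀ x ∈ U, x ≠ v → ∀ y, ∃ z ∈ U, z ≠ y ∧ G.Adj x z) :
    ∃ F S, IsGoodOn G F S ∧ S ⊆ U ∧ 3 ≤ S.ncard := by
  classical
  have := Fintype.ofFinite V
  have main : ∀ n : ℕ, ∀ x x₁ : V, ∀ (h : G.Adj x x₁) (p : G.Walk x₁ v), (Walk.cons h p).IsPath →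
      (∀ z ∈ (Walk.cons h p).support, z ∈ U) → Fintype.card V ≤ p.length + n →
      ∃ F S, IsGoodOn G F S ∧ S ⊆ U ∧ 3 ≤ S.ncard := by
    intro n
    induction n with
    | zero =>
      intro x x₁ h p hp _ hn
      have := hp.length_lt
      rw [Walk.length_cons] at this
      omega
    | succ n ih =>
      intro x x₁ h p hp hpU hn
      have hp' := (Walk.cons_isPath_iff h p).mp hp
      have hxv : x ≠ v := fun e => hp'.2 (e ▸ p.end_mem_support)
      obtain ⟨z, hzU, hz, hxz⟩ := hU x (hpU x (by simp)) hxv x₁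
      by_cases hzp : z ∈ p.support
      · refine ⟨_, _, (isGoodOn_singleton x).union_ear rfl rfl (hp'.1.takeUntil hzp)
          ?_ h hxz fun _ => hz.symm, ?_, ?_⟩
        · rintro y hy rfl
          exact hp'.2 (p.support_takeUntil_subset_support hzp hy)
        · rintro y (rfl | hy)
          · exact hpU y (by simp)
          · refine hpU y ?_
            rw [Walk.support_cons]
            exact List.mem_cons_of_mem _ (p.support_takeUntil_subset_support hzp hy)
        · rw [← Nat.lt_iff_add_one_le, Set.two_lt_ncard_iff (Set.toFinite _)]
          exact ⟨x, x₁, z, Or.inl rfl, Or.inr (Walk.start_mem_support _),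
            Or.inr (Walk.end_mem_support _), h.ne, hxz.ne, hz.symm⟩
      · refine ih z x hxz.symm (Walk.cons h p) ?_ ?_ ?_
        · rw [Walk.cons_isPath_iff]
          refine ⟨hp, fun hmem => ?_⟩
          rw [Walk.support_cons, List.mem_cons] at hmem
          exact hmem.elim hxz.ne' hzp
        · intro y hy
          rw [Walk.support_cons, List.mem_cons] at hy
          exact hy.elim (fun e => e ▸ hzU) (hpU y)
        · rw [Walk.length_cons]; omega
  refine main (Fintype.card V) u v huv Walk.nil ?_ ?_ (by simp)
  · simp [Walk.cons_isPath_iff, huv.ne]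
  · simp [hu, hv]

/-- `S` is good and cannot be enlarged to a bigger good set inside `U`. -/
structure IsMaxGoodIn (G : SimpleGraph V) (U S : Set V) : Prop where
  exists_good : ∃ F, IsGoodOn G F S
  subset : S ⊆ U
  max : ∀ F T, IsGoodOn G F T → S ⊆ T → T ⊆ U → T ⊆ S

lemma IsGoodOn.exists_isMaxGoodIn [Finite V] {F : Set (Sym2 V)} {U S₀ : Set V}
    (h : IsGoodOn G F S₀) (hU : S₀ ⊆ U) : ∃ S, S₀ ⊆ S ∧ IsMaxGoodIn G U S := by
  obtain ⟨S, hS, hmax⟩ :=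
    (Set.toFinite {S : Set V | (∃ F, IsGoodOn G F S) ∧ S ⊆ U}).exists_le_maximal
      (a := S₀) ⟨⟨F, h⟩, hU⟩
  exact ⟨S, hS, hmax.prop.1, hmax.prop.2,
    fun F' T hT hST hTU => hmax.le_of_ge ⟨⟨F', hT⟩, hTU⟩ hST⟩

namespace IsMaxGoodIn

variable {U S Q : Set V} {a b v w : V}

/-- A maximal good set has no ears. -/
lemma no_ear (h : IsMaxGoodIn G U S) (ha : a ∈ S) (hb : b ∈ S) (hQU : Q ⊆ U)
    (hQS : Disjoint Q S) (hvw : HasPathCount G ∅ Q 0 v w) (hav : G.Adj a v) (hbw : G.Adj b w) :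
    a = b ∧ v = w := by
  by_contra hne
  obtain ⟨F, hF⟩ := h.exists_good
  obtain ⟨q, hq, hqQ, -⟩ := hvw
  have hqS : ∀ z ∈ q.support, z ∉ S := fun z hz => Set.disjoint_left.mp hQS (hqQ z hz)
  have hgood := hF.union_ear ha hb hq hqS hav hbw fun e e' => hne ⟨e, e'⟩
  have hle := h.max _ _ hgood Set.subset_union_left
    (Set.union_subset h.subset fun z hz => hQU (hqQ z hz))
  exact hqS v q.start_mem_support (hle (Or.inr q.start_mem_support))

lemma adj_unique (h : IsMaxGoodIn G U S) (hvU : v ∈ U) (hv : v ∉ S) (ha : a ∈ S) (hb : b ∈ S)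
    (hva : G.Adj v a) (hvb : G.Adj v b) : a = b :=
  (h.no_ear (Q := {v}) ha hb (by simpa using hvU) (by simpa using hv) (.refl rfl) hva.symm
    hvb.symm).1

lemma not_adj (h : IsMaxGoodIn G U S) (hvU : v ∈ U) (hv : v ∉ S) (hwU : w ∈ U) (hw : w ∉ S)
    (ha : a ∈ S) (hb : b ∈ S) (hva : G.Adj v a) (hwb : G.Adj w b) : ¬ G.Adj v w := fun hvw =>
  hvw.ne (h.no_ear (Q := {v, w}) ha hb (by simp [Set.insert_subset_iff, hvU, hwU])
    (by simp [Set.disjoint_left, hv, hw])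
    (.of_adj hvw (by simp) (by simp)) hva.symm hwb.symm).2

end IsMaxGoodIn

lemma exists_other_neighbor [Finite V] {x : V} (h : 2 ≤ vdeg G x) (y : V) :
    ∃ z, z ≠ y ∧ G.Adj x z := by
  obtain ⟨z, hz, hzy⟩ := Set.exists_ne_of_one_lt_ncard (s := G.neighborSet x) h y
  exact ⟨z, hzy, hz⟩

/-- In a graph of minimum degree at least two, there is a good set with at least three
vertices in the complement of a maximal good set that some edge leaves. -/
lemma IsMaxGoodIn.exists_isGoodOn_compl [Finite V] (hδ : ∀ v, 2 ≤ vdeg G v)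
    {S : Set V} (hS : IsMaxGoodIn G Set.univ S) {a v : V} (ha : a ∈ S) (hv : v ∉ S)
    (hav : G.Adj a v) : ∃ F T, IsGoodOn G F T ∧ T ⊆ Sᶜ ∧ 3 ≤ T.ncard := by
  set C : Set V := {w | HasPathCount G ∅ Sᶜ 0 v w} with hC
  have hCS : C ⊆ Sᶜ := fun w hw => HasPathCount.right_mem hw
  have step : ∀ w ∈ C, ∀ z, G.Adj w z → z ∉ S → z ∈ C := fun w hw z hwz hz =>
    HasPathCount.trans_empty hw (.of_adj hwz (hCS hw) hz)
  have root : ∀ w ∈ C, ∀ z ∈ S, G.Adj w z → a = z ∧ v = w := fun w hw z hz hwz =>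
    hS.no_ear ha hz (Set.subset_univ _) disjoint_compl_left hw hav hwz.symm
  have hvC : v ∈ C := .refl hv
  obtain ⟨u, hua, hvu⟩ := exists_other_neighbor (hδ v) a
  have huC : u ∈ C := step v hvC u hvu fun h => hua (root v hvC u h hvu).1.symm
  obtain ⟨F, T, hT, hTC, hcard⟩ := exists_isGoodOn_subset hvC huC hvu.symm fun x hx hxv y => by
    obtain ⟨z, hzy, hxz⟩ := exists_other_neighbor (hδ x) y
    exact ⟨z, step x hx z hxz fun h => hxv (root x hx z h hxz).2.symm, hzy, hxz⟩
  exact ⟨F, T, hT, hTC.trans hCS, hcard⟩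

/-- If two disjoint maximal good sets miss at most two vertices of a graph of minimum degree at
least two, then some edge set `F` meets a path between any two non-adjacent vertices exactly once. -/
lemma exists_hasPathCount_of_two_isMaxGoodIn [Finite V] (hδ : ∀ v, 2 ≤ vdeg G v) {S T : Set V}
    (hS : IsMaxGoodIn G Set.univ S) (hT : IsMaxGoodIn G Sᶜ T) {a v : V} (ha : a ∈ S) (hv : v ∉ S)
    (hav : G.Adj a v) (hD : (S ∪ T)ᶜ.ncard ≤ 2) :
    ∃ F : Set (Sym2 V), ∀ x y, x ≠ y → G.Adj x y ∨ HasPathCount G F Set.univ 1 x y := by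
  obtain ⟨F₁, hF₁⟩ := hS.exists_good
  obtain ⟨F₂, hF₂⟩ := hT.exists_good
  have hST : Disjoint S T := Set.disjoint_right.mpr hT.subset
  have hTS : ∀ t ∈ T, t ∉ S := hT.subset
  have hcases : (S ∪ T)ᶜ.ncard = 0 ∨ (S ∪ T)ᶜ.ncard = 1 ∨ (S ∪ T)ᶜ.ncard = 2 := by omega
  rcases hcases with h | h | h
  · rw [Set.ncard_eq_zero] at h
    have hcov : ∀ x, x ∈ S ∨ x ∈ T := fun x => by
      by_contra hx
      exact h.le hx
    exact hF₁.isNearlyGoodOn.glue hF₂.isNearlyGoodOn hST hcov ha ((hcov v).resolve_left hv) hav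
  · obtain ⟨d, hd⟩ := Set.ncard_eq_one.mp h
    have hcov : ∀ x, x ∈ S ∨ x ∈ T ∨ x = d := by
      intro x
      have := Set.ext_iff.mp hd x
      simp only [Set.mem_compl_iff, Set.mem_union, Set.mem_singleton_iff] at this
      tauto
    have hdST : d ∉ S ∧ d ∉ T := by simpa using hd.ge rfl
    obtain ⟨hdS, hdT⟩ := hdST
    obtain ⟨x, -, hdx⟩ := exists_other_neighbor (hδ d) d
    obtain ⟨y, hyx, hdy⟩ := exists_other_neighbor (hδ d) x
    have finish : ∀ s ∈ S, ∀ t ∈ T, G.Adj d s → G.Adj d t →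
        ∃ F : Set (Sym2 V), ∀ x y, x ≠ y → G.Adj x y ∨ HasPathCount G F Set.univ 1 x y := by
      intro s hs t ht hds hdt
      refine hF₁.isNearlyGoodOn.glue (hF₂.insert_pendant hdT ht hdt) ?_ ?_ hs
        (Set.mem_insert _ _) hds.symm
      · rw [Set.disjoint_insert_right]
        exact ⟨hdS, hST⟩
      · intro x
        rw [Set.mem_insert_iff]
        have := hcov x
        tauto
    rcases hcov x with hx | hx | rfl
    · rcases hcov y with hy | hy | rfl
      · exact (hyx (hS.adj_unique trivial hdS hy hx hdy hdx)).elim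
      · exact finish x hx y hy hdx hdy
      · exact (hdy.ne rfl).elim
    · rcases hcov y with hy | hy | rfl
      · exact finish y hy x hx hdy hdx
      · exact (hyx (hT.adj_unique hdS hdT hy hx hdy hdx)).elim
      · exact (hdy.ne rfl).elim
    · exact (hdx.ne rfl).elim
  · obtain ⟨d, e, hde, hD⟩ := Set.ncard_eq_two.mp h
    have hcov : ∀ x, x ∈ S ∨ x ∈ T ∨ x = d ∨ x = e := by
      intro x
      have := Set.ext_iff.mp hD x
      simp only [Set.mem_compl_iff, Set.mem_union, Set.mem_insert_iff,
        Set.mem_singleton_iff] at this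
      tauto
    have hdST : d ∉ S ∧ d ∉ T := by simpa using hD.ge (Or.inl rfl)
    have heST : e ∉ S ∧ e ∉ T := by simpa using hD.ge (Or.inr rfl)
    obtain ⟨hdS, hdT⟩ := hdST
    obtain ⟨heS, heT⟩ := heST
    have nbr : ∀ d e, d ∉ S → d ∉ T → (∀ x, x ∈ S ∨ x ∈ T ∨ x = d ∨ x = e) →
        ((∃ s ∈ S, G.Adj d s) ∧ (∃ t ∈ T, G.Adj d t)) ∨
        (G.Adj d e ∧ ((∃ s ∈ S, G.Adj d s) ∨ (∃ t ∈ T, G.Adj d t))) := by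
      intro d e hdS hdT hcov
      obtain ⟨x, -, hdx⟩ := exists_other_neighbor (hδ d) d
      obtain ⟨y, hyx, hdy⟩ := exists_other_neighbor (hδ d) x
      have class_of : ∀ z, G.Adj d z → z ∈ S ∨ z ∈ T ∨ z = e := fun z hz => by
        have := hcov z
        have := hz.ne'
        tauto
      rcases class_of x hdx with hx | hx | rfl <;> rcases class_of y hdy with hy | hy | rfl
      · exact (hyx (hS.adj_unique trivial hdS hy hx hdy hdx)).elim
      · exact Or.inl ⟨⟨x, hx, hdx⟩, ⟨y, hy, hdy⟩⟩
      · exact Or.inr ⟨hdy, Or.inl ⟨x, hx, hdx⟩⟩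
      · exact Or.inl ⟨⟨y, hy, hdy⟩, ⟨x, hx, hdx⟩⟩
      · exact (hyx (hT.adj_unique hdS hdT hy hx hdy hdx)).elim
      · exact Or.inr ⟨hdy, Or.inr ⟨x, hx, hdx⟩⟩
      · exact Or.inr ⟨hdx, Or.inl ⟨y, hy, hdy⟩⟩
      · exact Or.inr ⟨hdx, Or.inr ⟨y, hy, hdy⟩⟩
      · exact (hyx rfl).elim
    have finish : ∀ d e, d ≠ e → d ∉ S → d ∉ T → e ∉ S → e ∉ T →
        (∀ x, x ∈ S ∨ x ∈ T ∨ x = d ∨ x = e) → ∀ s ∈ S, ∀ t ∈ T, G.Adj d s → G.Adj e t →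
        G.Adj d e →
        ∃ F : Set (Sym2 V), ∀ x y, x ≠ y → G.Adj x y ∨ HasPathCount G F Set.univ 1 x y := by
      intro d e hne hdS hdT heS heT hcov s hs t ht hds het hde
      refine (hF₁.insert_pendant hdS hs hds).glue (hF₂.insert_pendant heT ht het) ?_ ?_
        (Set.mem_insert _ _) (Set.mem_insert _ _) hde
      · simp [Set.disjoint_insert_left, Set.disjoint_insert_right, hne.symm, heS, hdT, hST]
      · intro x
        have := hcov x
        simp only [Set.mem_insert_iff]
        tauto
    have noS : ∀ s ∈ S, ∀ s' ∈ S, G.Adj d s → G.Adj e s' → ¬ G.Adj d e :=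
      fun s hs s' hs' => hS.not_adj trivial hdS trivial heS hs hs'
    have noT : ∀ t ∈ T, ∀ t' ∈ T, G.Adj d t → G.Adj e t' → ¬ G.Adj d e :=
      fun t ht t' ht' => hT.not_adj hdS hdT heS heT ht ht'
    have hcov' : ∀ x, x ∈ S ∨ x ∈ T ∨ x = e ∨ x = d := fun x => by
      have := hcov x
      tauto
    rcases nbr d e hdS hdT hcov with ⟨⟨s, hs, hds⟩, ⟨t, ht, hdt⟩⟩ | ⟨hadj, hd⟩
    · rcases nbr e d heS heT hcov' with ⟨⟨s', hs', hes⟩, ⟨t', ht', het⟩⟩ |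
        ⟨hadj, ⟨s', hs', hes⟩ | ⟨t', ht', het⟩⟩
      · have hp : HasPathCount G ∅ Sᶜ 0 d e :=
          ((HasPathCount.of_adj hdt hdS (hTS t ht)).trans_empty
            ((hF₂.zero t ht t' ht').empty.mono hT.subset)).trans_empty
            (.of_adj het.symm (hTS t' ht') heS)
        exact (hde (hS.no_ear hs hs' (Set.subset_univ _) disjoint_compl_left hp hds.symm
          hes.symm).2).elim
      · exact (noS s hs s' hs' hds hes hadj.symm).elim
      · exact (noT t ht t' ht' hdt het hadj.symm).elim
    · have he : (∃ s ∈ S, G.Adj e s) ∨ (∃ t ∈ T, G.Adj e t) := by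
        rcases nbr e d heS heT hcov' with ⟨h, -⟩ | ⟨-, h⟩
        exacts [Or.inl h, h]
      rcases hd with ⟨s, hs, hds⟩ | ⟨t, ht, hdt⟩ <;> rcases he with ⟨s', hs', hes⟩ | ⟨t', ht', het⟩
      · exact (noS s hs s' hs' hds hes hadj).elim
      · exact finish d e hde hdS hdT heS heT hcov s hs t' ht' hds het hadj
      · exact finish e d hde.symm heS heT hdS hdT hcov' s' hs' t ht hes hdt hadj.symm
      · exact (noT t ht t' ht' hdt het hadj).elim

/-- A conflict-free coloring of a non-complete graph uses at least two colors. -/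
lemma two_le_of_isCFConnected (hnc : G ≠ ⊤) {k : ℕ} {c : Sym2 V → ℕ}
    (hc : ∀ e ∈ G.edgeSet, c e < k) (hcf : IsCFConnected G c) : 2 ≤ k := by
  by_contra hk
  refine hnc (eq_top_iff.mpr fun x y hxy => ?_)
  obtain ⟨p, -, col, hcol⟩ := hcf x y hxy
  have hzero : ∀ e ∈ p.edges, c e = 0 := fun e he => by
    have := hc e (p.edges_subset_edgeSet he)
    omega
  have hlen : p.length = 1 := by
    by_cases h0 : col = 0
    · rw [List.filter_eq_self.mpr fun e he => by simp [hzero e he, h0]] at hcol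
      rwa [Walk.length_edges] at hcol
    · rw [List.filter_eq_nil_iff.mpr fun e he => by simp [hzero e he, Ne.symm h0]] at hcol
      simp at hcol
  exact Walk.adj_of_length_eq_one hlen

end PathCounts

theorem stmt_14 {V : Type*} [Fintype V] (G : SimpleGraph V)
    (hn1 : 4 ≤ Fintype.card V) (hn2 : Fintype.card V ≤ 8)
    (hG : G.Connected) (hnc : G ≠ ⊤)
    (hlf : IsLinearForest (bridgeGraph G))
    (hδ : ∀ v, 2 ≤ vdeg G v) :
    cfcNum G = 2 := by
  have upper : ∃ F : Set (Sym2 V), ∀ x y, x ≠ y →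
      G.Adj x y ∨ HasPathCount G F Set.univ 1 x y := by
    obtain ⟨r⟩ := hG.nonempty
    obtain ⟨u, -, hru⟩ := exists_other_neighbor (hδ r) r
    obtain ⟨F₀, S₀, hS₀, -, hcard₀⟩ := exists_isGoodOn_subset (Set.mem_univ r) (Set.mem_univ u)
      hru.symm fun x _ _ y => by
        obtain ⟨z, hzy, hxz⟩ := exists_other_neighbor (hδ x) y
        exact ⟨z, trivial, hzy, hxz⟩
    obtain ⟨S, hS₀S, hS⟩ := hS₀.exists_isMaxGoodIn (Set.subset_univ _)
    have hScard : 3 ≤ S.ncard := hcard₀.trans (Set.ncard_le_ncard hS₀S)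
    by_cases hall : ∀ x, x ∈ S
    · obtain ⟨F, hF⟩ := hS.exists_good
      exact ⟨F, fun x y hxy =>
        Or.inr ((hF.one x (hall x) y (hall y) hxy).mono (Set.subset_univ _))⟩
    · push Not at hall
      obtain ⟨z, hz⟩ := hall
      have hne : S.Nonempty := Set.nonempty_of_ncard_ne_zero (by omega)
      obtain ⟨s, hs⟩ := hne
      obtain ⟨p⟩ := hG.preconnected s z
      obtain ⟨d, -, ha, hv⟩ := p.exists_boundary_dart S hs hz
      obtain ⟨F₁, T₀, hT₀, hT₀S, hcard₁⟩ := hS.exists_isGoodOn_compl hδ ha hv d.adj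
      obtain ⟨T, hT₀T, hT⟩ := hT₀.exists_isMaxGoodIn hT₀S
      have hTcard : 3 ≤ T.ncard := hcard₁.trans (Set.ncard_le_ncard hT₀T)
      refine exists_hasPathCount_of_two_isMaxGoodIn hδ hS hT ha hv d.adj ?_
      have h1 := Set.ncard_union_eq (Set.disjoint_right.mpr hT.subset : Disjoint S T)
      have h2 := Set.ncard_add_ncard_compl (S ∪ T)
      rw [Nat.card_eq_fintype_card] at h2
      omega
  obtain ⟨F, hF⟩ := upper
  have hmem := exists_isCFConnected_of_hasPathCount hF
  refine le_antisymm (Nat.sInf_le hmem) (le_csInf ⟨2, hmem⟩ ?_)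
  rintro k ⟨c, hc, hcf⟩
  exact two_le_of_isCFConnected hnc hc hcf
end

section
/- Let G be a connected non-complete graph of order n ≥ 16. If δ(G) ≥ (n−3)/4, then cfc(G) = 2. -/
open SimpleGraph

namespace SimpleGraph

variable {V : Type*} {G T : SimpleGraph V} {u v : V}

lemma Walk.reachable_deleteEdges (p : G.Walk u v) {e : Sym2 V} (h : e ∉ p.edges) :
    (G.deleteEdges {e}).Reachable u v :=
  ⟨p.toDeleteEdges {e} fun _ hf hfe => h (Set.mem_singleton_iff.1 hfe ▸ hf)⟩

/-- An edge `e` of a trail from `u` to `v` can be oriented as `(a, b)` so that deleting it keeps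
`u` joined to `a` and `b` joined to `v`. -/
lemma Walk.IsTrail.exists_reachable_deleteEdges {p : G.Walk u v} (hp : p.IsTrail) {e : Sym2 V}
    (he : e ∈ p.edges) : ∃ a b, e = s(a, b) ∧ (G.deleteEdges {e}).Reachable u a ∧
      (G.deleteEdges {e}).Reachable b v := by
  induction p with
  | nil => simp at he
  | @cons x y z h q ih =>
    rw [Walk.isTrail_cons] at hp
    by_cases hxy : e = s(x, y)
    · subst hxy
      exact ⟨x, y, rfl, .rfl, q.reachable_deleteEdges hp.2⟩
    · have heq : e ∈ q.edges := by simpa [hxy] using he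
      obtain ⟨a, b, hab, ha, hb⟩ := ih hp.1 heq
      refine ⟨a, b, hab, .trans ?_ ha, hb⟩
      exact (Adj.reachable (by simpa [deleteEdges_adj, h] using fun h' => hxy h'.symm))

lemma IsBridge.not_reachable_of_mem_edges {e : Sym2 V} (hb : G.IsBridge e) {p : G.Walk u v}
    (hp : p.IsTrail) (he : e ∈ p.edges) : ¬ (G.deleteEdges {e}).Reachable u v := by
  obtain ⟨a, b, rfl, ha, hb'⟩ := hp.exists_reachable_deleteEdges he
  exact fun h => isBridge_iff.1 hb ((ha.symm.trans h).trans hb'.symm)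

lemma Connected.reachable_deleteEdges_or (hT : T.Connected) {p : T.Walk u v} (hp : p.IsTrail)
    {e : Sym2 V} (he : e ∈ p.edges) (w : V) :
    (T.deleteEdges {e}).Reachable u w ∨ (T.deleteEdges {e}).Reachable w v := by
  obtain ⟨a, b, hab, ha, hb⟩ := hp.exists_reachable_deleteEdges he
  obtain ⟨r⟩ := hT.preconnected u w
  rw [reachable_comm (u := u)]
  induction r using Walk.concatRec with
  | Hnil => exact .inl .rfl
  | @Hconcat x y z q h ih =>
    by_cases hyz : s(y, z) = e
    · rw [hab, Sym2.eq_iff] at hyz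
      rcases hyz with ⟨-, rfl⟩ | ⟨-, rfl⟩
      · exact .inr hb
      · exact .inl ha.symm
    · have hzy : (T.deleteEdges {e}).Reachable z y :=
        (Adj.reachable (by simpa [deleteEdges_adj, h] using hyz)).symm
      exact (ih hp he ha).imp hzy.trans hzy.trans

/-- If the path joining `u` and `v` in a spanning tree uses an edge that is not a bridge, then `u`
and `v` are joined by a path with exactly one edge outside the tree. -/
lemma IsTree.exists_isPath_of_not_isBridge (hT : T.IsTree) (hTG : T ≤ G) {p : T.Walk u v}
    (hp : p.IsTrail) {e : Sym2 V} (he : e ∈ p.edges) (hb : ¬ G.IsBridge e) :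
    ∃ q : G.Walk u v, q.IsPath ∧ ∃ f ∈ q.edges, f ∉ T.edgeSet ∧
      ∀ g ∈ q.edges, g ≠ f → g ∈ T.edgeSet := by
  classical
  have hsep := (isAcyclic_iff_forall_isBridge.1 hT.isAcyclic
    (p.edges_subset_edgeSet he)).not_reachable_of_mem_edges hp he
  have hconn : (G.deleteEdges {e}).Connected := by
    induction e with
    | h a b => exact (hT.connected.mono hTG).connected_delete_edge_of_not_isBridge hb
  obtain ⟨r⟩ := hconn.preconnected u v
  obtain ⟨d, -, hx, hy⟩ :=
    r.exists_boundary_dart {w | (T.deleteEdges {e}).Reachable u w} .rfl hsep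
  simp only [Set.mem_ofPred_eq] at hx hy
  have hd := d.adj
  rw [deleteEdges_adj, Set.mem_singleton_iff] at hd
  have hdT : s(d.fst, d.snd) ∉ T.edgeSet := fun h =>
    hy (hx.trans (Adj.reachable (by simpa [deleteEdges_adj, hd.2] using h)))
  obtain ⟨q₁⟩ := hx
  obtain ⟨q₂⟩ := (hT.connected.reachable_deleteEdges_or hp he d.snd).resolve_left hy
  have hle : T.deleteEdges {e} ≤ G := (deleteEdges_le _).trans hTG
  let q : G.Walk u v := (q₁.mapLe hle).append (.cons hd.1 (q₂.mapLe hle))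
  have hq : ∀ g ∈ q.bypass.edges, g ≠ s(d.fst, d.snd) → g ∈ (T.deleteEdges {e}).edgeSet := by
    intro g hg hgd
    have hg' := q.edges_bypass_subset_edges hg
    simp only [q, Walk.edges_append, Walk.edges_cons, List.mem_append, List.mem_cons, hgd,
      false_or, Walk.edges_mapLe_eq_edges] at hg'
    exact hg'.elim (fun h => q₁.edges_subset_edgeSet h) fun h => q₂.edges_subset_edgeSet h
  refine ⟨q.bypass, q.bypass_isPath, s(d.fst, d.snd), ?_, hdT, fun g hg hgd =>
    edgeSet_mono (deleteEdges_le _) (hq g hg hgd)⟩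
  by_contra hdq
  exact hsep ⟨q.bypass.transfer _ fun g hg => hq g hg fun h => hdq (h ▸ hg)⟩

lemma IsBridge.card_connectedComponent_lt [Finite V] {e : Sym2 V} (hb : G.IsBridge e)
    (he : e ∈ G.edgeSet) :
    Nat.card G.ConnectedComponent < Nat.card (G.deleteEdges {e}).ConnectedComponent := by
  classical
  have := Fintype.ofFinite G.ConnectedComponent
  have := Fintype.ofFinite (G.deleteEdges {e}).ConnectedComponent
  rw [Nat.card_eq_fintype_card, Nat.card_eq_fintype_card]
  refine Fintype.card_lt_of_surjective_not_injective
    (ConnectedComponent.map (Hom.ofLE (deleteEdges_le {e}))) ?_ ?_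
  · rintro ⟨w⟩
    exact ⟨connectedComponentMk _ w, rfl⟩
  · induction e with
    | h a b =>
      intro hinj
      refine isBridge_iff.1 hb (ConnectedComponent.exact (hinj ?_))
      exact ConnectedComponent.sound (Adj.reachable he)

lemma card_lt_card_connectedComponent_deleteEdges [Finite V] (hG : G.Connected)
    (B : Finset (Sym2 V)) (hB : ∀ e ∈ B, G.IsBridge e ∧ e ∈ G.edgeSet) :
    B.card < Nat.card (G.deleteEdges B).ConnectedComponent := by
  classical
  induction B using Finset.induction_on with
  | empty =>
    have := hG.nonempty
    have : Nonempty (G.deleteEdges ((∅ : Finset (Sym2 V)) : Set (Sym2 V))).ConnectedComponent :=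
      this.map (connectedComponentMk _)
    simp
  | insert e B he ih =>
    have h := ih fun f hf => hB f (Finset.mem_insert_of_mem hf)
    have heB := hB e (Finset.mem_insert_self e B)
    have hlt := (heB.1.anti (deleteEdges_le (B : Set (Sym2 V)))).card_connectedComponent_lt
      (by simpa [edgeSet_deleteEdges, he] using heB.2)
    rw [deleteEdges_deleteEdges] at hlt
    rw [Finset.card_insert_of_notMem he, Finset.coe_insert, Set.insert_eq, Set.union_comm]
    omega

/-- If `S` sends at most `d - 1` edges to its complement in a graph of minimum degree at least `d`,
then `S` has more than `d` vertices. -/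
lemma lt_card_of_edges_out_subset [Finite V] {d : ℕ} (hd : ∀ v, d ≤ (G.neighborSet v).ncard)
    {S : Finset V} (hS : S.Nonempty) {B : Finset (Sym2 V)} (hB : B.card < d)
    (hout : ∀ v ∈ S, ∀ w ∉ S, G.Adj v w → s(v, w) ∈ B) : d < S.card := by
  classical
  have := Fintype.ofFinite V
  by_contra! hle
  have hpos := hS.card_pos
  let D : Finset (V × V) := {x | x.1 ∈ S ∧ G.Adj x.1 x.2}
  have hD : S.card * d ≤ D.card := by
    have hmaps : ∀ x ∈ D, x.1 ∈ S := by simp +contextual [D]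
    rw [Finset.card_eq_sum_card_fiberwise hmaps, ← smul_eq_mul]
    refine Finset.card_nsmul_le_sum _ _ _ fun v hv => (hd v).trans ?_
    rw [Set.ncard_eq_toFinset_card']
    refine Finset.card_le_card_of_injOn (fun w => (v, w)) ?_ ?_
    · intro w hw
      simpa [D, hv] using hw
    · intro a _ b _ h
      simpa using h
  have hin : (D.filter fun x => x.2 ∈ S).card ≤ S.card * S.card - S.card := by
    rw [← Finset.offDiag_card]
    refine Finset.card_le_card fun x hx => ?_
    simp only [D, Finset.mem_filter, Finset.mem_univ, true_and] at hx
    exact Finset.mem_offDiag.2 ⟨hx.1.1, hx.2, hx.1.2.ne⟩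
  have hnotin : (D.filter fun x => x.2 ∉ S).card ≤ B.card := by
    refine Finset.card_le_card_of_injOn (fun x => s(x.1, x.2)) ?_ ?_
    · intro x hx
      simp only [D, Finset.coe_filter, Finset.mem_filter, Finset.mem_univ, true_and,
        Set.mem_ofPred_eq] at hx
      exact hout _ hx.1.1 _ hx.2 hx.1.2
    · rintro ⟨a, b⟩ hx ⟨a', b'⟩ hy h
      simp only [D, Finset.coe_filter, Finset.mem_filter, Finset.mem_univ, true_and,
        Set.mem_ofPred_eq] at hx hy
      rcases Sym2.eq_iff.1 h with ⟨h₁, h₂⟩ | ⟨h₁, h₂⟩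
      · exact Prod.ext h₁ h₂
      · obtain rfl : a = b' := h₁
        exact absurd hx.1.1 hy.2
  have hsum := Finset.card_filter_add_card_filter_not (s := D) (fun x => x.2 ∈ S)
  obtain ⟨k, rfl⟩ := Nat.exists_eq_add_of_le hle
  have hsq : S.card * S.card - S.card + S.card = S.card * S.card :=
    Nat.sub_add_cancel (Nat.le_mul_self _)
  nlinarith [Nat.zero_le k]

/-- A connected graph of minimum degree at least `d` with a set of fewer than `d` bridges has many
vertices. -/
lemma Connected.card_bridges_mul_le [Fintype V] (hG : G.Connected) {d : ℕ}
    (hd : ∀ v, d ≤ (G.neighborSet v).ncard) (B : Finset (Sym2 V))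
    (hB : ∀ e ∈ B, G.IsBridge e ∧ e ∈ G.edgeSet) (hBd : B.card < d) :
    (B.card + 1) * (d + 1) ≤ Fintype.card V := by
  classical
  let H := G.deleteEdges (B : Set (Sym2 V))
  have := Fintype.ofFinite H.ConnectedComponent
  have hcard : B.card + 1 ≤ Fintype.card H.ConnectedComponent := by
    rw [← Nat.card_eq_fintype_card]
    exact card_lt_card_connectedComponent_deleteEdges hG B hB
  refine (Nat.mul_le_mul_right _ hcard).trans ?_
  have hmaps : ∀ x ∈ (Finset.univ : Finset V),
    H.connectedComponentMk x ∈ (Finset.univ : Finset H.ConnectedComponent) := by simp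
  rw [← Finset.card_univ, ← Finset.card_univ, Finset.card_eq_sum_card_fiberwise hmaps,
    ← smul_eq_mul]
  refine Finset.card_nsmul_le_sum _ _ _ fun c _ => ?_
  refine lt_card_of_edges_out_subset hd ?_ hBd ?_
  · obtain ⟨w, rfl⟩ := c.exists_rep
    exact ⟨w, Finset.mem_filter.2 ⟨Finset.mem_univ w, rfl⟩⟩
  · intro v hv w hw hvw
    simp only [Finset.mem_filter, Finset.mem_univ, true_and] at hv hw
    by_contra hnot
    refine hw (Eq.trans (ConnectedComponent.sound (Adj.reachable ?_)) hv)
    simpa [H, deleteEdges_adj, hvw.symm, Sym2.eq_swap] using hnot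

end SimpleGraph

lemma List.Nodup.length_filter_eq_one {α : Type*} {l : List α} (hl : l.Nodup) {a : α} (ha : a ∈ l)
    {P : α → Prop} [DecidablePred P] (hP : ∀ b ∈ l, P b ↔ b = a) :
    (l.filter (fun b => P b)).length = 1 := by
  classical
  rw [List.filter_congr (q := fun b => b == a) fun b hb => by
      rw [Bool.eq_iff_iff]; simp [hP b hb],
    ← List.countP_eq_length_filter]
  exact List.count_eq_one_of_mem hl ha

/-- If at most one bridge of a connected graph differs from `b`, and `b` is a bridge or not an edge,
then the graph has a conflict-free connection coloring with two colors. -/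
lemma exists_isCFConnected_of_bridges {V : Type*} {G : SimpleGraph V} (hG : G.Connected)
    {b : Sym2 V} (hb : b ∈ G.edgeSet → G.IsBridge b)
    (hbridge : ∀ e e', G.IsBridge e → G.IsBridge e' → e ≠ b → e' ≠ b → e = e') :
    ∃ c : Sym2 V → ℕ, (∀ e, c e < 2) ∧ IsCFConnected G c := by
  classical
  obtain ⟨T, hTG, hT⟩ := hG.exists_isTree_le
  let c : Sym2 V → ℕ := fun e => if e ∈ T.edgeSet ∧ e ≠ b then 0 else 1
  have hc : ∀ e, c e = 1 ↔ (e ∈ T.edgeSet → e = b) := by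
    intro e
    simp only [c]
    split_ifs with h <;> simp <;> tauto
  have hc0 : ∀ e, c e = 0 ↔ e ∈ T.edgeSet ∧ e ≠ b := by
    intro e
    simp [c]
  refine ⟨c, fun e => by simp only [c]; split_ifs <;> norm_num, fun u v huv => ?_⟩
  obtain ⟨p, hp⟩ := hT.connected.exists_isPath u v
  have hpT : ∀ e ∈ p.edges, e ∈ T.edgeSet := fun e he => p.edges_subset_edgeSet he
  have hpG : (p.mapLe hTG).IsPath := hp.mapLe hTG
  by_cases hbp : b ∈ p.edges
  · refine ⟨p.mapLe hTG, hpG, 1, ?_⟩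
    rw [Walk.edges_mapLe_eq_edges]
    exact hp.isTrail.edges_nodup.length_filter_eq_one hbp fun e he =>
      (hc e).trans ⟨fun h => h (hpT e he), fun h _ => h⟩
  by_cases hall : ∃ e ∈ p.edges, ¬ G.IsBridge e
  · obtain ⟨e, he, heb⟩ := hall
    obtain ⟨q, hq, f, hf, hfT, hqT⟩ := hT.exists_isPath_of_not_isBridge hTG hp.isTrail he heb
    refine ⟨q, hq, 1, hq.isTrail.edges_nodup.length_filter_eq_one hf fun g hg => ?_⟩
    have hbq : b ∉ q.edges := fun h =>
      (hb (q.edges_subset_edgeSet h)).not_reachable_of_mem_edges hq.isTrail h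
        ((p.mapLe hTG).reachable_deleteEdges (by rwa [Walk.edges_mapLe_eq_edges]))
    rw [hc]
    refine ⟨fun h => ?_, fun h hgT => absurd (h ▸ hgT) hfT⟩
    by_contra hgf
    exact hbq (h (hqT g hg hgf) ▸ hg)
  · push Not at hall
    obtain ⟨e, he⟩ : ∃ e, e ∈ p.edges := by
      cases p with
      | nil => exact absurd rfl huv
      | cons h q => exact ⟨_, List.mem_cons_self⟩
    refine ⟨p.mapLe hTG, hpG, 0, ?_⟩
    rw [Walk.edges_mapLe_eq_edges]
    have hne : ∀ g ∈ p.edges, g ≠ b := fun g hg h => hbp (h ▸ hg)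
    refine hp.isTrail.edges_nodup.length_filter_eq_one he fun g hg => (hc0 g).trans ⟨fun _ => ?_,
      fun _ => ⟨hpT g hg, hne g hg⟩⟩
    exact hbridge g e (hall g hg) (hall e he) (hne g hg) (hne e he)

/-- A conflict-free connection coloring of a non-complete graph uses at least two colors. -/
lemma IsCFConnected.two_le {V : Type*} {G : SimpleGraph V} (hnc : G ≠ ⊤) {c : Sym2 V → ℕ} {k : ℕ}
    (hck : ∀ e ∈ G.edgeSet, c e < k) (h : IsCFConnected G c) : 2 ≤ k := by
  by_contra! hk
  refine hnc (eq_top_iff.2 fun u v huv => ?_)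
  obtain ⟨p, -, col, hcol⟩ := h u v huv
  have hc : ∀ e ∈ p.edges, c e = 0 := fun e he => by
    have := hck e (p.edges_subset_edgeSet he)
    omega
  obtain ⟨f, hf⟩ := List.exists_mem_of_length_pos (hcol ▸ Nat.one_pos)
  simp only [List.mem_filter, decide_eq_true_eq] at hf
  have hcol0 : col = 0 := hf.2 ▸ hc f hf.1
  rw [List.filter_eq_self.2 fun e he => by simp [hc e he, hcol0], Walk.length_edges] at hcol
  exact Walk.adj_of_length_eq_one hcol

theorem stmt_15 {V : Type*} [Fintype V] (G : SimpleGraph V)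
    (hn : 16 ≤ Fintype.card V) (hG : G.Connected) (hnc : G ≠ ⊤)
    (hδ : ∀ v, ((Fintype.card V : ℚ) - 3) / 4 ≤ (vdeg G v : ℚ)) :
    cfcNum G = 2 := by
  classical
  have hd : ∀ v, Fintype.card V / 4 ≤ (G.neighborSet v).ncard := by
    intro v
    have h : (Fintype.card V : ℚ) ≤ 4 * vdeg G v + 3 := by linarith [hδ v]
    have h' : Fintype.card V ≤ 4 * vdeg G v + 3 := by exact_mod_cast h
    unfold vdeg at h'
    omega
  have hedge : ∀ e, G.IsBridge e → e ∈ G.edgeSet := by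
    intro e he
    induction e with
    | h x y => exact he.reachable_iff_adj.1 (hG.preconnected x y)
  have hthree : ∀ e₁ e₂ e₃, G.IsBridge e₁ → G.IsBridge e₂ → G.IsBridge e₃ → e₁ ≠ e₂ → e₁ ≠ e₃ →
      e₂ = e₃ := by
    intro e₁ e₂ e₃ h₁ h₂ h₃ h₁₂ h₁₃
    by_contra h₂₃
    have hcard : ({e₁, e₂, e₃} : Finset (Sym2 V)).card = 3 :=
      Finset.card_eq_three.2 ⟨_, _, _, h₁₂, h₁₃, h₂₃, rfl⟩
    have hB : ∀ e ∈ ({e₁, e₂, e₃} : Finset (Sym2 V)), G.IsBridge e ∧ e ∈ G.edgeSet := by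
      intro e he
      have he' : G.IsBridge e := by
        simp only [Finset.mem_insert, Finset.mem_singleton] at he
        rcases he with rfl | rfl | rfl <;> assumption
      exact ⟨he', hedge e he'⟩
    have := hG.card_bridges_mul_le hd _ hB (by omega)
    rw [hcard] at this
    omega
  obtain ⟨c, hc, hcf⟩ : ∃ c : Sym2 V → ℕ, (∀ e, c e < 2) ∧ IsCFConnected G c := by
    by_cases hex : ∃ b, G.IsBridge b
    · obtain ⟨b, hb⟩ := hex
      exact exists_isCFConnected_of_bridges hG (fun _ => hb) fun e e' he he' hne hne' =>
        hthree b e e' hb he he' hne.symm hne'.symm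
    · push Not at hex
      obtain ⟨x⟩ := hG.nonempty
      exact exists_isCFConnected_of_bridges (b := s(x, x)) hG (fun h => absurd h (by simp))
        fun e _ he => absurd he (hex e)
  have hmem : 2 ∈ {k | ∃ c : Sym2 V → ℕ, (∀ e ∈ G.edgeSet, c e < k) ∧ IsCFConnected G c} :=
    ⟨c, fun e _ => hc e, hcf⟩
  refine le_antisymm (Nat.sInf_le hmem) (le_csInf ⟨2, hmem⟩ ?_)
  rintro k ⟨c', hc', hcf'⟩
  exact hcf'.two_le hnc hc'
end
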